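/- arXiv:math/0110136 — 5 statements merged into one kernel-verified Lean document; each statement's English description precedes it below -/
import Mathlib

section
/- Let a₁, a₂, a₃ ∈ A and let q_{st} ∈ k (1 ≤ s,t ≤ 3) be nonzero scalars satisfying q₂₂ ≠ −1, q₁₂·q₂₁·q₂₂ = 1 and q₂₃·q₃₂·q₂₂ = 1. If [a₂, [a₂,a₁]_{q₂₁}]_{q₂₁·q₂₂} = 0, [a₂, [a₂,a₃]_{q₂₃}]_{q₂₃·q₂₂} = 0 and [a₁,a₃]_{q₁₃} = 0, then [[[a₁,a₂]_{q₁₂}, a₃]_{q₁₃·q₂₃}, a₂]_{q₁₂·q₂₂·q₃₂} = 0. (The technical Lemma 'brcomm-an', with q_{st} = χ_t(g_s).) -/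
/-- The `α`-commutator `[x, y]_α := x·y − α·y·x` in a `k`-algebra `A`. -/
def brc {k A : Type*} [Field k] [Ring A] [Algebra k A] (α : k) (x y : A) : A :=
  x * y - α • (y * x)

/-- The technical Lemma `brcomm-an` (with `q_{st} = χ_t(g_s)`): under the stated
hypotheses, `[[[a₁,a₂]_{q₁₂}, a₃]_{q₁₃·q₂₃}, a₂]_{q₁₂·q₂₂·q₃₂} = 0`. -/
theorem brcomm_an {k A : Type*} [Field k] [Ring A] [Algebra k A]
    (a₁ a₂ a₃ : A) (q₁₂ q₁₃ q₂₁ q₂₂ q₂₃ q₃₂ : k)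
    (h12 : q₁₂ ≠ 0) (h13 : q₁₃ ≠ 0) (h21 : q₂₁ ≠ 0) (h22 : q₂₂ ≠ 0)
    (h23 : q₂₃ ≠ 0) (h32 : q₃₂ ≠ 0)
    (hq22 : q₂₂ ≠ -1)
    (htechni2 : q₁₂ * q₂₁ * q₂₂ = 1)
    (htechni3 : q₂₃ * q₃₂ * q₂₂ = 1)
    (htechni5 : brc (q₂₁ * q₂₂) a₂ (brc q₂₁ a₂ a₁) = 0)
    (htechni6 : brc (q₂₃ * q₂₂) a₂ (brc q₂₃ a₂ a₃) = 0)
    (htechni7 : brc q₁₃ a₁ a₃ = 0) :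
    brc (q₁₂ * q₂₂ * q₃₂) (brc (q₁₃ * q₂₃) (brc q₁₂ a₁ a₂) a₃) a₂ = 0 := by
  have hne : q₂₃ * (1 + q₂₂) ≠ 0 :=
    mul_ne_zero h23 fun h => hq22 (eq_neg_of_add_eq_zero_right h)
  refine (smul_eq_zero.mp ?_).resolve_left hne
  obtain rfl : q₂₁ = (q₁₂ * q₂₂)⁻¹ := eq_inv_of_mul_eq_one_left (by linear_combination htechni2)
  obtain rfl : q₃₂ = (q₂₃ * q₂₂)⁻¹ := eq_inv_of_mul_eq_one_left (by linear_combination htechni3)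
  set X := brc (((q₁₂ * q₂₂)⁻¹) * q₂₂) a₂ (brc (q₁₂ * q₂₂)⁻¹ a₂ a₁) with hX
  set Y := brc (q₂₃ * q₂₂) a₂ (brc q₂₃ a₂ a₃) with hY
  set Z := brc q₁₃ a₁ a₃ with hZ
  have key : (q₂₃ * (1 + q₂₂)) • brc (q₁₂ * q₂₂ * (q₂₃ * q₂₂)⁻¹)
      (brc (q₁₃ * q₂₃) (brc q₁₂ a₁ a₂) a₃) a₂ =
      (q₁₂ ^ 2 * q₂₂) • (X * a₃) - a₁ * Y - (q₁₃ * q₂₃ ^ 2 * (q₁₂ ^ 2 * q₂₂)) • (a₃ * X)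
      + (q₁₂ ^ 2 * q₁₃) • (Y * a₁) + (q₂₃ ^ 2 * q₂₂) • (Z * (a₂ * a₂))
      - (q₁₂ * q₂₃ * (1 + q₂₂)) • (a₂ * (Z * a₂)) + q₁₂ ^ 2 • (a₂ * (a₂ * Z)) := by
    simp only [hX, hY, hZ, brc, mul_sub, sub_mul, smul_mul_assoc, mul_smul_comm, mul_assoc]
    match_scalars <;> field_simp <;> ring
  rw [key, htechni5, htechni6, htechni7]
  simp
end

section
/- Assume relation (R1) holds in R. Then for all 1 ≤ i < j < p < r ≤ n+1 one has [e_{i,j}, e_{p,r}]_c = 0 and [e_{p,r}, e_{i,j}]_c = 0; that is, e_{i,j}·e_{p,r} = B(i,j;p,r)·e_{p,r}·e_{i,j} and e_{p,r}·e_{i,j} = B(p,r;i,j)·e_{i,j}·e_{p,r}. (Lemma 'lema2.2.200', equations (2.2.4) and (2.2.4bis).) -/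
/-- `B(i,j;p,r) = ∏_{i≤ℓ≤j−1} ∏_{p≤h≤r−1} q_{ℓ,h}`. -/
def Bq {k : Type*} [Field k] (qm : ℕ → ℕ → k) (i j p r : ℕ) : k :=
  ∏ l ∈ Finset.Ico i j, ∏ h ∈ Finset.Ico p r, qm l h

/-- The iterated braided commutators `e_{i,j}`: `e_{i,i+1} = x_i` and
`e_{i,j} = e_{i,j−1}·e_{j−1,j} − B(i,j−1;j−1,j)·e_{j−1,j}·e_{i,j−1}` for `j − i ≥ 2`. -/
def ee {k R : Type*} [Field k] [Ring R] [Algebra k R]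
    (qm : ℕ → ℕ → k) (x : ℕ → R) : ℕ → ℕ → R
  | i, j =>
    if _ : j ≤ i + 1 then x i
    else
      ee qm x i (j - 1) * ee qm x (j - 1) j
        - Bq qm i (j - 1) (j - 1) j • (ee qm x (j - 1) j * ee qm x i (j - 1))
  termination_by i j => j - i
  decreasing_by all_goals omega

theorem ee_succ_self {k R : Type*} [Field k] [Ring R] [Algebra k R]
    (qm : ℕ → ℕ → k) (x : ℕ → R) (i : ℕ) : ee qm x i (i + 1) = x i := by
  rw [ee, dif_pos le_rfl]

theorem ee_succ {k R : Type*} [Field k] [Ring R] [Algebra k R]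
    (qm : ℕ → ℕ → k) (x : ℕ → R) {i j : ℕ} (hij : i < j) :
    ee qm x i (j + 1) =
      ee qm x i j * x j - Bq qm i j j (j + 1) • (x j * ee qm x i j) := by
  rw [ee, dif_neg (by omega), Nat.add_sub_cancel, ee_succ_self]

/-- An element that skew-commutes with each generator of `e_{i,j}` on the right skew-commutes
with `e_{i,j}`. -/
theorem mul_ee_eq_smul {k R : Type*} [Field k] [Ring R] [Algebra k R]
    (qm : ℕ → ℕ → k) (x : ℕ → R) (y : R) (f : ℕ → k) {i j : ℕ} (hij : i < j)
    (h : ∀ l ∈ Finset.Ico i j, y * x l = f l • (x l * y)) :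
    y * ee qm x i j = (∏ l ∈ Finset.Ico i j, f l) • (ee qm x i j * y) := by
  induction j, hij using Nat.le_induction with
  | base => simpa [ee_succ_self] using h i (by simp)
  | succ j hij ih =>
    have hx := h j (by simp; omega)
    have he := ih fun l hl => h l (by simp at hl ⊢; omega)
    rw [ee_succ qm x hij, Finset.prod_Ico_succ_top (by omega), mul_sub, sub_mul,
      mul_smul_comm, ← mul_assoc, ← mul_assoc, hx, he]
    simp only [smul_mul_assoc, mul_assoc, hx, he, mul_smul_comm, smul_sub, smul_smul]
    congr 2; ring

/-- An element that skew-commutes with each generator of `e_{i,j}` on the left skew-commutes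
with `e_{i,j}`. -/
theorem ee_mul_eq_smul {k R : Type*} [Field k] [Ring R] [Algebra k R]
    (qm : ℕ → ℕ → k) (x : ℕ → R) (y : R) (f : ℕ → k) {i j : ℕ} (hij : i < j)
    (h : ∀ l ∈ Finset.Ico i j, x l * y = f l • (y * x l)) :
    ee qm x i j * y = (∏ l ∈ Finset.Ico i j, f l) • (y * ee qm x i j) := by
  induction j, hij using Nat.le_induction with
  | base => simpa [ee_succ_self] using h i (by simp)
  | succ j hij ih =>
    have hx := h j (by simp; omega)
    have he := ih fun l hl => h l (by simp at hl ⊢; omega)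
    rw [ee_succ qm x hij, Finset.prod_Ico_succ_top (by omega), mul_sub, sub_mul,
      mul_smul_comm, smul_mul_assoc, mul_assoc, mul_assoc, hx, he]
    simp only [mul_smul_comm, ← mul_assoc, hx, he, smul_mul_assoc, smul_sub, smul_smul]
    congr 2 <;> ring

theorem ee_mul_ee_eq_smul {k R : Type*} [Field k] [Ring R] [Algebra k R]
    (qm : ℕ → ℕ → k) (x : ℕ → R) {i j p r : ℕ} (hij : i < j) (hpr : p < r)
    (h : ∀ l ∈ Finset.Ico i j, ∀ m ∈ Finset.Ico p r, x l * x m = qm l m • (x m * x l)) :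
    ee qm x i j * ee qm x p r = Bq qm i j p r • (ee qm x p r * ee qm x i j) :=
  ee_mul_eq_smul qm x _ _ hij fun l hl => mul_ee_eq_smul qm x _ _ hpr (h l hl)

/-- Lemma `lema2.2.200`, equations (2.2.4) and (2.2.4bis): if (R1) holds, then
`[e_{i,j}, e_{p,r}]_c = 0` and `[e_{p,r}, e_{i,j}]_c = 0` for `i < j < p < r`. -/
theorem lema2_2_200_disjoint {k R : Type*} [Field k] [Ring R] [Algebra k R]
    (n N : ℕ) (hn : 1 ≤ n) (hN : 2 < N) (q : k) (hq : IsPrimitiveRoot q N)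
    (qm : ℕ → ℕ → k)
    (hqne : ∀ i j, 1 ≤ i → i ≤ n → 1 ≤ j → j ≤ n → qm i j ≠ 0)
    (hdiag : ∀ i, 1 ≤ i → i ≤ n → qm i i = q)
    (hadj : ∀ i j, 1 ≤ i → i ≤ n → 1 ≤ j → j ≤ n → (i = j + 1 ∨ j = i + 1) →
      qm i j * qm j i = q⁻¹)
    (hfar : ∀ i j, 1 ≤ i → i ≤ n → 1 ≤ j → j ≤ n → (i + 2 ≤ j ∨ j + 2 ≤ i) →
      qm i j * qm j i = 1)
    (x : ℕ → R)
    (R1 : ∀ i p, 1 ≤ i → i < p → p ≤ n → i + 2 ≤ p →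
      x i * x p = qm i p • (x p * x i)) :
    ∀ i j p r, 1 ≤ i → i < j → j < p → p < r → r ≤ n + 1 →
      ee qm x i j * ee qm x p r = Bq qm i j p r • (ee qm x p r * ee qm x i j) ∧
      ee qm x p r * ee qm x i j = Bq qm p r i j • (ee qm x i j * ee qm x p r) := by
  intro i j p r hi hij hjp hpr hr
  refine ⟨ee_mul_ee_eq_smul qm x hij hpr fun l hl m hm => ?_,
    ee_mul_ee_eq_smul qm x hpr hij fun m hm l hl => ?_⟩ <;>
  rw [Finset.mem_Ico] at hl hm
  · exact R1 l m (by omega) (by omega) (by omega) (by omega)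
  · rw [R1 l m (by omega) (by omega) (by omega) (by omega), smul_smul,
      hfar m l (by omega) (by omega) (by omega) (by omega) (by omega), one_smul]
end

section
/- Assume relation (R1) holds, i.e. a_i·a_p = q_{i,p}·a_p·a_i for all 1 ≤ i < p ≤ n with p−i ≥ 2. Then for all 1 ≤ i < j ≤ n+1 the comultiplication of the iterated commutator E_{i,j} is Δ(E_{i,j}) = E_{i,j} ⊗ 1 + g_{i,j} ⊗ E_{i,j} + (1 − q⁻¹)·Σ_{i<p<j} (E_{i,p}·g_{p,j}) ⊗ E_{p,j}. (Lemma 'lema2.2.2' in its bosonized form, Remark 'ochopuntotres', formula (boson-delta).) -/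
open TensorProduct

/-- `g_{i,j} := g_i·g_{i+1}·⋯·g_{j−1}`. -/
def gp {H : Type*} [Monoid H] (g : ℕ → H) (i j : ℕ) : H :=
  (((List.range (j - i)).map fun t => g (i + t))).prod

section Commutators

variable {k R : Type*} [Field k] [Ring R] [Algebra k R]

theorem Bq_succ_right (qm : ℕ → ℕ → k) (i j p : ℕ) :
    Bq qm i j p (p + 1) = ∏ l ∈ Finset.Ico i j, qm l p := by
  simp [Bq]

theorem ee_self_succ (qm : ℕ → ℕ → k) (x : ℕ → R) (i : ℕ) : ee qm x i (i + 1) = x i := by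
  rw [ee]
  simp

theorem ee_succ_right (qm : ℕ → ℕ → k) (x : ℕ → R) {i j : ℕ} (h : i < j) :
    ee qm x i (j + 1) =
      ee qm x i j * x j - (∏ l ∈ Finset.Ico i j, qm l j) • (x j * ee qm x i j) := by
  rw [ee, dif_neg (by omega), Nat.add_sub_cancel, ee_self_succ, Bq_succ_right]

theorem mul_ee (qm : ℕ → ℕ → k) (x : ℕ → R) (y : R) (c : ℕ → k) {i j : ℕ} (hij : i < j)
    (h : ∀ l ∈ Finset.Ico i j, y * x l = c l • (x l * y)) :
    y * ee qm x i j = (∏ l ∈ Finset.Ico i j, c l) • (ee qm x i j * y) := by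
  induction j, hij using Nat.le_induction with
  | base => simpa [ee_self_succ] using h
  | succ j hij ih =>
    have hj := h j (by simp; omega)
    have hE := ih fun l hl => h l (Finset.Ico_subset_Ico_right j.le_succ hl)
    rw [ee_succ_right qm x hij, Finset.prod_Ico_succ_top (by omega), mul_sub, sub_mul,
      mul_smul_comm, ← mul_assoc, ← mul_assoc, hE, hj, smul_mul_assoc, smul_mul_assoc, mul_assoc,
      mul_assoc, hj, hE]
    simp only [mul_smul_comm, smul_mul_assoc, smul_sub, smul_smul, mul_assoc]
    congr 2
    ring

theorem ee_mul (qm : ℕ → ℕ → k) (x : ℕ → R) (y : R) (c : ℕ → k) {i j : ℕ} (hij : i < j)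
    (h : ∀ l ∈ Finset.Ico i j, x l * y = c l • (y * x l)) :
    ee qm x i j * y = (∏ l ∈ Finset.Ico i j, c l) • (y * ee qm x i j) := by
  induction j, hij using Nat.le_induction with
  | base => simpa [ee_self_succ] using h
  | succ j hij ih =>
    have hj := h j (by simp; omega)
    have hE := ih fun l hl => h l (Finset.Ico_subset_Ico_right j.le_succ hl)
    rw [ee_succ_right qm x hij, Finset.prod_Ico_succ_top (by omega), mul_sub, sub_mul,
      smul_mul_assoc, mul_assoc, mul_assoc, hE, hj, mul_smul_comm, mul_smul_comm, ← mul_assoc,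
      ← mul_assoc, hj, hE]
    simp only [mul_smul_comm, smul_mul_assoc, smul_sub, smul_smul, mul_assoc]
    congr 2 <;> ring

theorem gp_self {H : Type*} [Monoid H] (g : ℕ → H) (i : ℕ) : gp g i i = 1 := by
  simp [gp]

theorem gp_succ_right {H : Type*} [Monoid H] (g : ℕ → H) {i j : ℕ} (h : i ≤ j) :
    gp g i (j + 1) = gp g i j * g j := by
  simp [gp, Nat.succ_sub h, List.range_succ, h]

theorem gp_mul (g : ℕ → R) (y : R) (c : ℕ → k) {i j : ℕ} (hij : i ≤ j)
    (h : ∀ l ∈ Finset.Ico i j, g l * y = c l • (y * g l)) :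
    gp g i j * y = (∏ l ∈ Finset.Ico i j, c l) • (y * gp g i j) := by
  induction j, hij using Nat.le_induction with
  | base => simp [gp_self]
  | succ j hij ih =>
    have hj := h j (by simp; omega)
    have hG := ih fun l hl => h l (Finset.Ico_subset_Ico_right j.le_succ hl)
    rw [gp_succ_right g hij, Finset.prod_Ico_succ_top hij, mul_assoc, hj, mul_smul_comm,
      ← mul_assoc, hG, smul_mul_assoc, smul_smul, mul_assoc, mul_comm]

theorem commute_gp {H : Type*} [Monoid H] (g : ℕ → H) (y : H) {i j : ℕ}
    (h : ∀ l ∈ Finset.Ico i j, y * g l = g l * y) : Commute y (gp g i j) := by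
  refine Commute.list_prod_right _ _ fun z hz => ?_
  obtain ⟨t, ht, rfl⟩ := List.mem_map.mp hz
  rw [List.mem_range] at ht
  exact h (i + t) (Finset.mem_Ico.mpr (by omega))

/-- The `β`-commutator of `u ⊗ v` with `a ⊗ 1 + g ⊗ a`, when `u` commutes with `a` and `g` up to
scalars and the terms involving `a ⊗ 1` cancel. -/
theorem tmul_qcommutator_skewPrimitive (u v a g : R) (β γ : k)
    (ha : u * a = β • (a * u)) (hg : g * u = γ • (u * g)) :
    (u ⊗ₜ[k] v) * (a ⊗ₜ[k] 1 + g ⊗ₜ[k] a) - β • ((a ⊗ₜ[k] 1 + g ⊗ₜ[k] a) * (u ⊗ₜ[k] v)) =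
      (u * g) ⊗ₜ[k] (v * a - (β * γ) • (a * v)) := by
  simp only [mul_add, add_mul, Algebra.TensorProduct.tmul_mul_tmul, mul_one, one_mul, ha, hg,
    tmul_sub, smul_add, ← smul_tmul', tmul_smul, smul_smul]
  abel

/-- The `β`-commutator of `u ⊗ 1` with `a ⊗ 1 + g ⊗ a`. -/
theorem tmul_one_qcommutator_skewPrimitive (u a g : R) (β γ : k) (hg : g * u = γ • (u * g)) :
    (u ⊗ₜ[k] 1) * (a ⊗ₜ[k] 1 + g ⊗ₜ[k] a) - β • ((a ⊗ₜ[k] 1 + g ⊗ₜ[k] a) * (u ⊗ₜ[k] 1)) =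
      (u * a - β • (a * u)) ⊗ₜ[k] 1 + (1 - β * γ) • ((u * g) ⊗ₜ[k] a) := by
  simp only [mul_add, add_mul, Algebra.TensorProduct.tmul_mul_tmul, mul_one, one_mul, hg,
    sub_tmul, smul_add, ← smul_tmul', smul_smul, sub_smul, one_smul]
  abel

end Commutators

/-- Lemma `lema2.2.2` in bosonized form (Remark `ochopuntotres`, formula (boson-delta)):
`Δ(E_{i,j}) = E_{i,j} ⊗ 1 + g_{i,j} ⊗ E_{i,j} + (1 − q⁻¹)·Σ_{i<p<j} (E_{i,p}·g_{p,j}) ⊗ E_{p,j}`. -/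
theorem boson_delta {k H : Type*} [Field k] [Ring H] [HopfAlgebra k H]
    (n N : ℕ) (hn : 1 ≤ n) (hN : 2 < N) (q : k) (hq : IsPrimitiveRoot q N)
    (qm : ℕ → ℕ → k)
    (hqne : ∀ i j, 1 ≤ i → i ≤ n → 1 ≤ j → j ≤ n → qm i j ≠ 0)
    (hdiag : ∀ i, 1 ≤ i → i ≤ n → qm i i = q)
    (hadj : ∀ i j, 1 ≤ i → i ≤ n → 1 ≤ j → j ≤ n → (i = j + 1 ∨ j = i + 1) →
      qm i j * qm j i = q⁻¹)
    (hfar : ∀ i j, 1 ≤ i → i ≤ n → 1 ≤ j → j ≤ n → (i + 2 ≤ j ∨ j + 2 ≤ i) →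
      qm i j * qm j i = 1)
    (g a : ℕ → H)
    (hgunit : ∀ i, 1 ≤ i → i ≤ n → IsUnit (g i))
    (hgcomm : ∀ i j, 1 ≤ i → i ≤ n → 1 ≤ j → j ≤ n → g i * g j = g j * g i)
    (hglike : ∀ i, 1 ≤ i → i ≤ n →
      Coalgebra.comul (R := k) (g i) = g i ⊗ₜ[k] g i)
    (hgcounit : ∀ i, 1 ≤ i → i ≤ n → Coalgebra.counit (R := k) (g i) = 1)
    (hskew : ∀ i, 1 ≤ i → i ≤ n →
      Coalgebra.comul (R := k) (a i) = a i ⊗ₜ[k] 1 + g i ⊗ₜ[k] a i)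
    (hga : ∀ i j, 1 ≤ i → i ≤ n → 1 ≤ j → j ≤ n → g i * a j = qm i j • (a j * g i))
    (R1 : ∀ i p, 1 ≤ i → i < p → p ≤ n → i + 2 ≤ p →
      a i * a p = qm i p • (a p * a i))
    : ∀ i j, 1 ≤ i → i < j → j ≤ n + 1 →
      Coalgebra.comul (R := k) (ee qm a i j)
        = ee qm a i j ⊗ₜ[k] 1 + gp g i j ⊗ₜ[k] ee qm a i j
          + (1 - q⁻¹) • ∑ p ∈ Finset.Ioo i j,
              (ee qm a i p * gp g p j) ⊗ₜ[k] ee qm a p j := by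
  intro i j hi hij
  induction j, hij using Nat.le_induction with
  | base =>
    intro hj
    have hempty : Finset.Ioo i (i + 1) = ∅ := by
      ext p
      simp
    simp [hempty, ee_self_succ, gp_succ_right, gp_self, hskew i hi (by omega)]
  | succ j hij ih =>
    intro hj
    replace hij : i < j := hij
    have hjn : j ≤ n := by omega
    have hj1 : 1 ≤ j := by omega
    have hfar_prod : ∀ p, p < j →
        (∏ l ∈ Finset.Ico i p, qm l j) * ∏ l ∈ Finset.Ico i p, qm j l = 1 := by
      intro p hp
      rw [← Finset.prod_mul_distrib]
      refine Finset.prod_eq_one fun l hl => ?_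
      rw [Finset.mem_Ico] at hl
      exact hfar l j (by omega) (by omega) hj1 hjn (by omega)
    have hprod : (∏ l ∈ Finset.Ico i j, qm l j) * ∏ l ∈ Finset.Ico i j, qm j l = q⁻¹ := by
      obtain ⟨m, rfl⟩ : ∃ m, j = m + 1 := ⟨j - 1, by omega⟩
      rw [Finset.prod_Ico_succ_top (by omega), Finset.prod_Ico_succ_top (by omega),
        mul_mul_mul_comm, hfar_prod m (by omega), one_mul]
      exact hadj m (m + 1) (by omega) (by omega) hj1 hjn (by omega)
    have hgE : ∀ p, i < p → p ≤ j →
        g j * ee qm a i p = (∏ l ∈ Finset.Ico i p, qm j l) • (ee qm a i p * g j) := by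
      intro p hip hpj
      refine mul_ee qm a _ (qm j) hip fun l hl => ?_
      rw [Finset.mem_Ico] at hl
      exact hga j l hj1 hjn (by omega) (by omega)
    have hGa : ∀ p, i ≤ p → p ≤ j →
        gp g p j * a j = (∏ l ∈ Finset.Ico p j, qm l j) • (a j * gp g p j) := by
      intro p hip hpj
      refine gp_mul g _ (fun l => qm l j) hpj fun l hl => ?_
      rw [Finset.mem_Ico] at hl
      exact hga l j (by omega) (by omega) hj1 hjn
    have hgG : ∀ p, i ≤ p → g j * gp g p j = gp g p j * g j := by
      intro p hip
      refine commute_gp g _ fun l hl => ?_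
      rw [Finset.mem_Ico] at hl
      exact hgcomm j l hj1 hjn (by omega) (by omega)
    have hterm : ∀ p ∈ Finset.Ioo i j,
        ((ee qm a i p * gp g p j) ⊗ₜ[k] ee qm a p j) * (a j ⊗ₜ[k] 1 + g j ⊗ₜ[k] a j) -
          (∏ l ∈ Finset.Ico i j, qm l j) • ((a j ⊗ₜ[k] 1 + g j ⊗ₜ[k] a j) *
            ((ee qm a i p * gp g p j) ⊗ₜ[k] ee qm a p j)) =
        (ee qm a i p * gp g p (j + 1)) ⊗ₜ[k] ee qm a p (j + 1) := by
      intro p hp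
      obtain ⟨hip, hpj⟩ := Finset.mem_Ioo.mp hp
      have hsplit := Finset.prod_Ico_consecutive (fun l => qm l j) hip.le hpj.le
      have hEa : ee qm a i p * a j = (∏ l ∈ Finset.Ico i p, qm l j) • (a j * ee qm a i p) := by
        refine ee_mul qm a _ (fun l => qm l j) hip fun l hl => ?_
        rw [Finset.mem_Ico] at hl
        exact R1 l j (by omega) (by omega) hjn (by omega)
      rw [tmul_qcommutator_skewPrimitive _ _ _ _ _ (∏ l ∈ Finset.Ico i p, qm j l),
        ee_succ_right qm a hpj, gp_succ_right g hpj.le, mul_assoc, ← hsplit, mul_right_comm,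
        hfar_prod p hpj, one_mul]
      · rw [mul_assoc, hGa p hip.le hpj.le, mul_smul_comm, ← mul_assoc, hEa, smul_mul_assoc,
          smul_smul, mul_assoc, ← hsplit, mul_comm]
      · rw [← mul_assoc, hgE p hip hpj.le, smul_mul_assoc, mul_assoc, hgG p hip.le,
          mul_assoc]
    have hsum := Finset.sum_congr rfl hterm
    have hgrp := tmul_qcommutator_skewPrimitive (gp g i j) (ee qm a i j) (a j) (g j) _ (1 : k)
      (hGa i le_rfl hij.le) (by rw [one_smul, hgG i le_rfl])
    have hone := tmul_one_qcommutator_skewPrimitive (ee qm a i j) (a j) (g j)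
      (∏ l ∈ Finset.Ico i j, qm l j) _ (hgE j hij le_rfl)
    rw [mul_one, ← ee_succ_right qm a hij, ← gp_succ_right g hij.le] at hgrp
    rw [hprod, ← ee_succ_right qm a hij] at hone
    have hIoo : Finset.Ioo i (j + 1) = insert j (Finset.Ioo i j) := by
      ext p
      simp only [Finset.mem_Ioo, Finset.mem_insert]
      omega
    rw [hIoo, Finset.sum_insert (by simp), ← hsum, gp_succ_right g le_rfl, gp_self, one_mul,
      ee_self_succ, smul_add, Finset.sum_sub_distrib, ← Finset.sum_mul, ← Finset.smul_sum,
      ← Finset.mul_sum]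
    have hgoal : ∀ (X Y S D P Q W : H ⊗[k] H) (β c : k),
        X * D - β • (D * X) = P + W → Y * D - β • (D * Y) = Q →
        (X + Y + c • S) * D - β • (D * (X + Y + c • S)) =
          P + Q + (W + c • (S * D - β • (D * S))) := by
      rintro X Y S D P Q W β c hX rfl
      rw [← sub_eq_iff_eq_add] at hX
      rw [← hX]
      simp only [add_mul, mul_add, smul_mul_assoc, mul_smul_comm, smul_add, smul_sub,
        smul_comm β c]
      abel
    rw [← hgoal _ _ _ _ _ _ _ _ _ hone hgrp, ← ih (by omega), ← hskew j hj1 hjn,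
      ee_succ_right qm a hij, map_sub, map_smul, Bialgebra.comul_mul, Bialgebra.comul_mul]
end

section
/- Let γ = (γ_{i,j})_{1≤i<j≤n+1} be an arbitrary family of scalars in k, and define elements u_{i,j}(γ) ∈ kΓ recursively (by induction on j−i) by u_{i,j}(γ) = γ_{i,j}·(1 − h_{i,j}) + Σ_{i<p<j} C^j_{i,p}·γ_{i,p}·u_{p,j}(γ). Then for all 1 ≤ i < j ≤ n+1, u_{i,j}(γ) = Σ_{i≤p<j} φ^j_{i,p}(γ)·(1 − h_{p,j}), where φ^j_{i,p}(γ) := Σ over all integers kk ≥ 1 and all chains i = i₁ < i₂ < ⋯ < i_{kk} = p of C^j_{i₁,i₂}·⋯·C^j_{i_{kk−1},i_{kk}}·γ_{i₁,i₂}·⋯·γ_{i_{kk−1},i_{kk}}·γ_{p,j} (in particular φ^j_{i,i}(γ) = γ_{i,j}, corresponding to the chain of length 1). (Remark 'explicit', part 1.) -/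
/-- The elements `u_{i,j}(γ) ∈ kΓ`, defined by induction on `j − i` by
`u_{i,j}(γ) = γ_{i,j}·(1 − h_{i,j}) + Σ_{i<p<j} C^j_{i,p}·γ_{i,p}·u_{p,j}(γ)`. -/
noncomputable def uu {k Γ : Type*} [Field k] [CommGroup Γ]
    (h : ℕ → ℕ → Γ) (C : ℕ → ℕ → ℕ → k) (γ : ℕ → ℕ → k) :
    ℕ → ℕ → MonoidAlgebra k Γ
  | i, j =>
    γ i j • ((1 : MonoidAlgebra k Γ) - MonoidAlgebra.of k Γ (h i j))
      + ∑ p ∈ (Finset.Ioo i j).attach,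
          (C j i p.1 * γ i p.1) • uu h C γ p.1 j
  termination_by i j => j - i
  decreasing_by
    have := Finset.mem_Ioo.mp p.2
    omega

/-- `φ^j_{i,p}(γ)`: the sum over all chains `i = i₁ < i₂ < ⋯ < i_kk = p` (`kk ≥ 1`) of
`C^j_{i₁,i₂}·⋯·C^j_{i_{kk−1},i_kk}·γ_{i₁,i₂}·⋯·γ_{i_{kk−1},i_kk}·γ_{p,j}`.  A chain is
encoded by its set `S` of intermediate points, a subset of the interval `(i,p)`. -/
noncomputable def phi {k : Type*} [Field k]
    (C : ℕ → ℕ → ℕ → k) (γ : ℕ → ℕ → k) (j i p : ℕ) : k :=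
  if p = i then γ i j
  else ∑ S ∈ (Finset.Ioo i p).powerset,
    (let l := (i :: S.sort (· ≤ ·)) ++ [p]
     ((l.zip l.tail).map fun pr => C j pr.1 pr.2 * γ pr.1 pr.2).prod) * γ p j

/-- The product of the weights `f` over the consecutive pairs of the chain that runs from `i`
to `p` through the points of `S`. -/
def chainWeight {k : Type*} [CommSemiring k] (f : ℕ → ℕ → k) (i p : ℕ) (S : Finset ℕ) : k :=
  ((((i :: S.sort (· ≤ ·)) ++ [p]).zip ((i :: S.sort (· ≤ ·)) ++ [p]).tail).map
    fun pr => f pr.1 pr.2).prod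

theorem chainWeight_empty {k : Type*} [CommSemiring k] (f : ℕ → ℕ → k) (i p : ℕ) :
    chainWeight f i p ∅ = f i p := by
  simp [chainWeight]

theorem chainWeight_insert {k : Type*} [CommSemiring k] (f : ℕ → ℕ → k) (i p : ℕ) {m : ℕ}
    {S : Finset ℕ} (hS : ∀ b ∈ S, m < b) :
    chainWeight f i p (insert m S) = f i m * chainWeight f m p S := by
  have hm : m ∉ S := fun h => lt_irrefl m (hS m h)
  simp [chainWeight, Finset.sort_insert (· ≤ ·) (fun b hb => (hS b hb).le) hm]

theorem sum_chainWeight {k : Type*} [CommSemiring k] (f : ℕ → ℕ → k) (i p a : ℕ) :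
    ∑ S ∈ (Finset.Ioo a p).powerset, chainWeight f i p S
      = f i p + ∑ m ∈ Finset.Ioo a p,
          f i m * ∑ S ∈ (Finset.Ioo m p).powerset, chainWeight f m p S := by
  by_cases h : a + 1 < p
  · have hI : Finset.Ioo a p = insert (a + 1) (Finset.Ioo (a + 1) p) := by
      ext x
      simp only [Finset.mem_insert, Finset.mem_Ioo]
      omega
    have hn : a + 1 ∉ Finset.Ioo (a + 1) p := by simp
    have hw : ∀ S ∈ (Finset.Ioo (a + 1) p).powerset,
        chainWeight f i p (insert (a + 1) S) = f i (a + 1) * chainWeight f (a + 1) p S :=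
      fun S hS => chainWeight_insert f i p fun b hb =>
        (Finset.mem_Ioo.mp (Finset.mem_powerset.mp hS hb)).1
    rw [hI, Finset.sum_powerset_insert hn, Finset.sum_insert hn, sum_chainWeight f i p (a + 1),
      Finset.sum_congr rfl hw, ← Finset.mul_sum]
    ring
  · have hI : Finset.Ioo a p = ∅ := by
      ext x
      simp only [Finset.mem_Ioo, Finset.notMem_empty, iff_false]
      omega
    simp [hI, chainWeight_empty]
  termination_by p - a

theorem phi_self {k : Type*} [Field k] (C : ℕ → ℕ → ℕ → k) (γ : ℕ → ℕ → k) (j i : ℕ) :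
    phi C γ j i i = γ i j := by
  simp [phi]

theorem phi_of_lt {k : Type*} [Field k] (C : ℕ → ℕ → ℕ → k) (γ : ℕ → ℕ → k) (j : ℕ)
    {i p : ℕ} (h : i < p) :
    phi C γ j i p = (∑ S ∈ (Finset.Ioo i p).powerset,
      chainWeight (fun a b => C j a b * γ a b) i p S) * γ p j := by
  rw [phi, if_neg h.ne', Finset.sum_mul]
  rfl

/-- Splitting a chain at its second point. -/
theorem phi_eq_sum {k : Type*} [Field k] (C : ℕ → ℕ → ℕ → k) (γ : ℕ → ℕ → k) (j : ℕ)
    {i q : ℕ} (h : i < q) :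
    phi C γ j i q = ∑ p ∈ Finset.Ioc i q, (C j i p * γ i p) * phi C γ j p q := by
  rw [phi_of_lt C γ j h, sum_chainWeight, ← Finset.Ioo_insert_right h,
    Finset.sum_insert (by simp), phi_self, add_mul, Finset.sum_mul]
  congr 1
  refine Finset.sum_congr rfl fun p hp => ?_
  rw [phi_of_lt C γ j (Finset.mem_Ioo.mp hp).2, mul_assoc]

theorem uu_eq_sum {k Γ : Type*} [Field k] [CommGroup Γ]
    (h : ℕ → ℕ → Γ) (C : ℕ → ℕ → ℕ → k) (γ : ℕ → ℕ → k) (i j : ℕ) (hij : i < j) :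
    uu h C γ i j
      = ∑ p ∈ Finset.Ico i j,
          phi C γ j i p • ((1 : MonoidAlgebra k Γ) - MonoidAlgebra.of k Γ (h p j)) := by
  rw [uu, Finset.sum_attach (Finset.Ioo i j) fun p => (C j i p * γ i p) • uu h C γ p j,
    ← Finset.Ioo_insert_left hij, Finset.sum_insert (by simp), phi_self]
  congr 1
  have hu : ∀ p ∈ Finset.Ioo i j, (C j i p * γ i p) • uu h C γ p j
      = ∑ q ∈ Finset.Ico p j, ((C j i p * γ i p) * phi C γ j p q) •
          ((1 : MonoidAlgebra k Γ) - MonoidAlgebra.of k Γ (h q j)) := by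
    intro p hp
    have := Finset.mem_Ioo.mp hp
    rw [uu_eq_sum h C γ p j this.2, Finset.smul_sum]
    simp only [smul_smul]
  have hphi : ∀ q ∈ Finset.Ioo i j,
      phi C γ j i q • ((1 : MonoidAlgebra k Γ) - MonoidAlgebra.of k Γ (h q j))
      = ∑ p ∈ Finset.Ioc i q, ((C j i p * γ i p) * phi C γ j p q) •
          ((1 : MonoidAlgebra k Γ) - MonoidAlgebra.of k Γ (h q j)) := by
    intro q hq
    rw [phi_eq_sum C γ j (Finset.mem_Ioo.mp hq).1, Finset.sum_smul]
  rw [Finset.sum_congr rfl hu, Finset.sum_congr rfl hphi]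
  refine Finset.sum_comm' fun p q => ?_
  simp only [Finset.mem_Ioo, Finset.mem_Ico, Finset.mem_Ioc]
  omega
  termination_by j - i

/-- Remark `explicit`, part 1: for any family of scalars `γ`,
`u_{i,j}(γ) = Σ_{i≤p<j} φ^j_{i,p}(γ)·(1 − h_{p,j})`. -/
theorem explicit_formula {k Γ : Type*} [Field k] [CommGroup Γ] [Fintype Γ]
    (n : ℕ) (hn : 1 ≤ n)
    (h : ℕ → ℕ → Γ) (C : ℕ → ℕ → ℕ → k)
    (hC0 : ∀ i p j, 1 ≤ i → i < p → p < j → j ≤ n + 1 → C j i p ≠ 0)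
    (γ : ℕ → ℕ → k) :
    ∀ i j, 1 ≤ i → i < j → j ≤ n + 1 →
      uu h C γ i j
        = ∑ p ∈ Finset.Ico i j,
            phi C γ j i p •
              ((1 : MonoidAlgebra k Γ) - MonoidAlgebra.of k Γ (h p j)) := by
  exact fun i j _ hij _ => uu_eq_sum h C γ i j hij
end

section
/- Let γ = (γ_{i,j})_{1≤i<j≤n+1} and γ̃ = (γ̃_{i,j})_{1≤i<j≤n+1} be families of scalars in k such that γ_{i,j} = 0 and γ̃_{i,j} = 0 whenever h_{i,j} = 1, and define u_{i,j}(γ), u_{i,j}(γ̃) ∈ kΓ recursively by u_{i,j}(γ) = γ_{i,j}·(1 − h_{i,j}) + Σ_{i<p<j} C^j_{i,p}·γ_{i,p}·u_{p,j}(γ) (and similarly for γ̃). If u_{i,j}(γ) = u_{i,j}(γ̃) for all 1 ≤ i < j ≤ n+1, then γ = γ̃. (Remark 'explicit', part 2.) -/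
/-- Remark `explicit`, part 2: if two families `γ`, `γ̃` of scalars both vanish whenever
`h_{i,j} = 1` and `u_{i,j}(γ) = u_{i,j}(γ̃)` for all `1 ≤ i < j ≤ n+1`, then `γ = γ̃`. -/
theorem explicit_injective {k Γ : Type*} [Field k] [CommGroup Γ] [Fintype Γ]
    (n : ℕ) (hn : 1 ≤ n)
    (h : ℕ → ℕ → Γ) (C : ℕ → ℕ → ℕ → k)
    (hC0 : ∀ i p j, 1 ≤ i → i < p → p < j → j ≤ n + 1 → C j i p ≠ 0)
    (γ γ' : ℕ → ℕ → k)
    (hγ : ∀ i j, 1 ≤ i → i < j → j ≤ n + 1 → h i j = 1 → γ i j = 0)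
    (hγ' : ∀ i j, 1 ≤ i → i < j → j ≤ n + 1 → h i j = 1 → γ' i j = 0)
    (hu : ∀ i j, 1 ≤ i → i < j → j ≤ n + 1 →
      uu h C γ i j = (uu h C γ' i j : MonoidAlgebra k Γ)) :
    ∀ i j, 1 ≤ i → i < j → j ≤ n + 1 → γ i j = γ' i j := by
  intro i j
  induction hd : j - i using Nat.strong_induction_on generalizing i j with
  | _ d ih =>
    intro hi hij hj
    by_cases h1 : h i j = 1
    · rw [hγ i j hi hij hj h1, hγ' i j hi hij hj h1]
    have e := hu i j hi hij hj
    rw [uu, uu] at e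
    have hsum : ∑ p ∈ (Finset.Ioo i j).attach, (C j i p.1 * γ i p.1) • uu h C γ p.1 j =
        ∑ p ∈ (Finset.Ioo i j).attach, (C j i p.1 * γ' i p.1) • uu h C γ' p.1 j := by
      refine Finset.sum_congr rfl fun p _ => ?_
      obtain ⟨hip, hpj⟩ := Finset.mem_Ioo.mp p.2
      rw [ih (p.1 - i) (by omega) i p.1 rfl hi hip (by omega),
        hu p.1 j (by omega) hpj hj]
    rw [hsum] at e
    have hne : (1 : MonoidAlgebra k Γ) - MonoidAlgebra.of k Γ (h i j) ≠ 0 := by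
      intro h0
      apply h1
      apply MonoidAlgebra.of_injective (R := k)
      rw [map_one]
      exact (sub_eq_zero.mp h0).symm
    exact smul_left_injective k hne (add_right_cancel e)
end
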